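/- arXiv:2302.01539 — 2 statements merged into one kernel-verified Lean document; each statement's English description precedes it below -/
import Mathlib

section
/- Let d ≥ 1, L ≥ 0, β > 0, r > 0, and set n = r^{−β} (so that n^{−1/β} = r). Let μ : [0,1]^d → ℝ be L-Lipschitz with respect to the sup-norm ‖·‖_∞, and let x* ∈ [0,1]^d be a global minimizer of μ over [0,1]^d. Let x₁, x₂ ∈ [0,1]^d with ‖x₁ − x*‖_∞ ≤ r, and let ℓ₁, ℓ₂ ∈ ℝ satisfy |ℓ₁ − μ(x₁)| ≤ n^{−1/β} and |ℓ₂ − μ(x₂)| ≤ n^{−1/β}. Then ℓ₁ − ℓ₂ ≤ (2L+2)·r. In particular, under the elimination rule that discards a point y when its observed loss exceeds the minimum observed loss by more than (2L+2)·r, the cube containing the optimal arm x* is never eliminated. -/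
/-- Lemma 3 of the paper: the observed loss of the representative arm of the
cube containing the global minimizer exceeds any other observed loss by at most `(2L+2)r`;
hence under the elimination rule the cube containing the optimal arm is never eliminated. -/
theorem blie_optimal_cube_not_eliminated
    (d : ℕ) (hd : 1 ≤ d) (L : ℝ) (hL : 0 ≤ L) (β : ℝ) (hβ : 0 < β)
    (r : ℝ) (hr : 0 < r) (n : ℝ) (hn : n = r ^ (-β))
    (μ : (Fin d → ℝ) → ℝ)
    (hLip : ∀ x₁ x₂ : Fin d → ℝ, x₁ ∈ Set.Icc (0 : Fin d → ℝ) 1 →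
      x₂ ∈ Set.Icc (0 : Fin d → ℝ) 1 → |μ x₁ - μ x₂| ≤ L * ‖x₁ - x₂‖)
    (xstar : Fin d → ℝ) (hxstar : xstar ∈ Set.Icc (0 : Fin d → ℝ) 1)
    (hmin : ∀ x ∈ Set.Icc (0 : Fin d → ℝ) 1, μ xstar ≤ μ x)
    (x₁ x₂ : Fin d → ℝ)
    (hx₁ : x₁ ∈ Set.Icc (0 : Fin d → ℝ) 1) (hx₂ : x₂ ∈ Set.Icc (0 : Fin d → ℝ) 1)
    (hclose : ‖x₁ - xstar‖ ≤ r)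
    (ℓ₁ ℓ₂ : ℝ)
    (hℓ₁ : |ℓ₁ - μ x₁| ≤ n ^ (-(1 : ℝ) / β))
    (hℓ₂ : |ℓ₂ - μ x₂| ≤ n ^ (-(1 : ℝ) / β)) :
    ℓ₁ - ℓ₂ ≤ (2 * L + 2) * r := by
  have hnr : n ^ (-(1 : ℝ) / β) = r := by
    rw [hn, ← Real.rpow_mul hr.le, show -β * (-(1 : ℝ) / β) = 1 by field_simp, Real.rpow_one]
  rw [hnr] at hℓ₁ hℓ₂
  have hμ₁ : μ x₁ - μ xstar ≤ L * r :=
    (le_abs_self _).trans <| (hLip x₁ xstar hx₁ hxstar).trans <|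
      mul_le_mul_of_nonneg_left hclose hL
  linarith [le_abs_self (ℓ₁ - μ x₁), neg_abs_le (ℓ₂ - μ x₂), hmin x₂ hx₂, mul_nonneg hL hr.le]
end

section
/- Let d ≥ 1, L ≥ 0, β > 0, r > 0, and set n = r^{−β} (so that n^{−1/β} = r). Let μ : [0,1]^d → ℝ be L-Lipschitz with respect to the sup-norm ‖·‖_∞, and let x* ∈ [0,1]^d be a global minimizer of μ over [0,1]^d. Let x, x_p, x_q ∈ [0,1]^d satisfy ‖x − x_p‖_∞ ≤ r and ‖x_q − x*‖_∞ ≤ r, and let ℓ_p, ℓ_q ∈ ℝ satisfy |ℓ_p − μ(x_p)| ≤ n^{−1/β}, |ℓ_q − μ(x_q)| ≤ n^{−1/β}, and ℓ_p − ℓ_q ≤ (2L+2)·r. Then the optimality gap of x satisfies μ(x) − μ(x*) ≤ (4L+4)·r. -/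
/-- core of Lemma 1 of the paper: every arm `x` in a cube of edge length `r`
that survived the elimination rule has optimality gap at most `(4L+4)r`. -/
theorem blie_surviving_cube_gap
    (d : ℕ) (hd : 1 ≤ d) (L : ℝ) (hL : 0 ≤ L) (β : ℝ) (hβ : 0 < β)
    (r : ℝ) (hr : 0 < r) (n : ℝ) (hn : n = r ^ (-β))
    (μ : (Fin d → ℝ) → ℝ)
    (hLip : ∀ x₁ x₂ : Fin d → ℝ, x₁ ∈ Set.Icc (0 : Fin d → ℝ) 1 →
      x₂ ∈ Set.Icc (0 : Fin d → ℝ) 1 → |μ x₁ - μ x₂| ≤ L * ‖x₁ - x₂‖)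
    (xstar : Fin d → ℝ) (hxstar : xstar ∈ Set.Icc (0 : Fin d → ℝ) 1)
    (hmin : ∀ y ∈ Set.Icc (0 : Fin d → ℝ) 1, μ xstar ≤ μ y)
    (x xp xq : Fin d → ℝ)
    (hx : x ∈ Set.Icc (0 : Fin d → ℝ) 1)
    (hxp : xp ∈ Set.Icc (0 : Fin d → ℝ) 1) (hxq : xq ∈ Set.Icc (0 : Fin d → ℝ) 1)
    (hxxp : ‖x - xp‖ ≤ r) (hxqstar : ‖xq - xstar‖ ≤ r)
    (ℓp ℓq : ℝ)
    (hℓp : |ℓp - μ xp| ≤ n ^ (-(1 : ℝ) / β))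
    (hℓq : |ℓq - μ xq| ≤ n ^ (-(1 : ℝ) / β))
    (helim : ℓp - ℓq ≤ (2 * L + 2) * r) :
    μ x - μ xstar ≤ (4 * L + 4) * r := by
  have hnr : n ^ (-(1 : ℝ) / β) = r := by
    rw [hn, ← Real.rpow_mul hr.le, show -β * (-(1 : ℝ) / β) = 1 by field_simp, Real.rpow_one]
  rw [hnr] at hℓp hℓq
  have hxp_gap : μ x - μ xp ≤ L * r :=
    (le_abs_self _).trans ((hLip x xp hx hxp).trans (mul_le_mul_of_nonneg_left hxxp hL))
  have hxq_gap : μ xq - μ xstar ≤ L * r :=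
    (le_abs_self _).trans
      ((hLip xq xstar hxq hxstar).trans (mul_le_mul_of_nonneg_left hxqstar hL))
  linarith [(abs_le.mp hℓp).1, (abs_le.mp hℓq).2]
end
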